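/- Let n be a prime number, let 1 ≤ k ≤ n − 1, and let Φ : B_H → B_H be an ℝ-linear map such that the image of P_k under Φ equals P_k (i.e., Φ maps the set of rank-k Hermitian projections surjectively onto itself). Then Φ is of Wigner form: there exists an n×n unitary matrix U such that either Φ(X) = U X U* for all X ∈ B_H, or Φ(X) = U Xᵀ U* for all X ∈ B_H. -/

import Mathlib

open Matrix

noncomputable section

/-- `BH n` is the real vector space of `n × n` complex Hermitian (self-adjoint) matrices. -/
abbrev BH (n : ℕ) := selfAdjoint (Matrix (Fin n) (Fin n) ℂ)

/-- `projSet n k` is the set of rank-`k` Hermitian projections, viewed inside `BH n`. -/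
def projSet (n k : ℕ) : Set (BH n) :=
  {P | (P : Matrix (Fin n) (Fin n) ℂ) * (P : Matrix (Fin n) (Fin n) ℂ) = (P : Matrix (Fin n) (Fin n) ℂ)
    ∧ (P : Matrix (Fin n) (Fin n) ℂ).rank = k}

/-- A map is of Wigner form if it is `X ↦ U X U†` or `X ↦ U Xᵀ U†` for some unitary `U`. -/
def WignerForm (n : ℕ) (Φ : BH n →ₗ[ℝ] BH n) : Prop :=
  ∃ U ∈ Matrix.unitaryGroup (Fin n) ℂ,
    (∀ X : BH n, (Φ X : Matrix (Fin n) (Fin n) ℂ) = U * (X : Matrix (Fin n) (Fin n) ℂ) * Uᴴ) ∨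
    (∀ X : BH n, (Φ X : Matrix (Fin n) (Fin n) ℂ) = U * (X : Matrix (Fin n) (Fin n) ℂ)ᵀ * Uᴴ)


namespace WF

variable {n : ℕ}

/-- Rank-one operator attached to a vector. -/
def op (v : Fin n → ℂ) : BH n :=
  ⟨vecMulVec v (star v), by
    rw [selfAdjoint.mem_iff, star_eq_conjTranspose, conjTranspose_vecMulVec, star_star]⟩

lemma op_coe (v : Fin n → ℂ) : (op v : Matrix (Fin n) (Fin n) ℂ) = vecMulVec v (star v) := rfl

lemma op_apply (v : Fin n → ℂ) (i j : Fin n) :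
    (op v : Matrix (Fin n) (Fin n) ℂ) i j = v i * star (v j) := rfl

/-- Trace inner product. -/
def ip : LinearMap.BilinForm ℝ (BH n) :=
  LinearMap.mk₂ ℝ (fun X Y => (trace ((X : Matrix (Fin n) (Fin n) ℂ) * (Y : Matrix (Fin n) (Fin n) ℂ))).re)
    (fun X X' Y => by simp [add_mul])
    (fun c X Y => by simp)
    (fun X Y Y' => by simp [mul_add])
    (fun c X Y => by simp)

lemma ip_def (X Y : BH n) : ip X Y =
    (trace ((X : Matrix (Fin n) (Fin n) ℂ) * (Y : Matrix (Fin n) (Fin n) ℂ))).re := rfl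

lemma ip_comm (X Y : BH n) : ip X Y = ip Y X := by
  rw [ip_def, ip_def, trace_mul_comm]

lemma ip_op (X : BH n) (v : Fin n → ℂ) :
    ip X (op v) = (star v ⬝ᵥ ((X : Matrix (Fin n) (Fin n) ℂ) *ᵥ v)).re := by
  rw [ip_def, op_coe, mul_vecMulVec, trace_vecMulVec, dotProduct_comm]

lemma ip_op_op (u v : Fin n → ℂ) : ip (op u) (op v) = Complex.normSq (star u ⬝ᵥ v) := by
  rw [ip_op, op_coe, vecMulVec_mulVec]
  have : star v ⬝ᵥ u = star (star u ⬝ᵥ v) := by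
    rw [star_dotProduct]
  simp only [dotProduct_smul, this, Complex.star_def]
  rw [MulOpposite.smul_eq_mul_unop, MulOpposite.unop_op, mul_comm, Complex.mul_conj]; simp

lemma ip_one (X : BH n) : ip 1 X = (trace (X : Matrix (Fin n) (Fin n) ℂ)).re := by
  rw [ip_def]; simp

lemma ip_one_op (v : Fin n → ℂ) : ip 1 (op v) = (star v ⬝ᵥ v).re := by
  rw [ip_op]; simp

lemma trace_im (X : BH n) : (trace (X : Matrix (Fin n) (Fin n) ℂ)).im = 0 := by
  have h : (X : Matrix (Fin n) (Fin n) ℂ)ᴴ = X := X.2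
  have := congrArg trace h
  rw [trace_conjTranspose] at this
  exact Complex.conj_eq_iff_im.1 this

/-- orthonormal frame -/
def Fr (u : Fin n → Fin n → ℂ) : Prop := ∀ i j, star (u i) ⬝ᵥ u j = if i = j then 1 else 0

lemma Fr.unit {u : Fin n → Fin n → ℂ} (h : Fr u) (i) : star (u i) ⬝ᵥ u i = 1 := by simp [h i i]

lemma Fr.unitary {u : Fin n → Fin n → ℂ} (h : Fr u) :
    (Matrix.of u)ᵀ ∈ unitaryGroup (Fin n) ℂ := by
  rw [mem_unitaryGroup_iff']
  ext i j
  rw [one_apply, ← h i j]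
  rfl

lemma Fr.of_unitary {U : Matrix (Fin n) (Fin n) ℂ} (h : U ∈ unitaryGroup (Fin n) ℂ) :
    Fr (fun i r => U r i) := by
  intro i j
  rw [mem_unitaryGroup_iff'] at h
  have := congrFun (congrFun h i) j
  rw [one_apply] at this
  rw [← this]; rfl

lemma Fr.conj_diag {u : Fin n → Fin n → ℂ} (c : Fin n → ℝ) :
    ((∑ i, c i • op (u i) : BH n) : Matrix (Fin n) (Fin n) ℂ) =
      (Matrix.of u)ᵀ * diagonal (fun i => (c i : ℂ)) * ((Matrix.of u)ᵀ)ᴴ := by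
  ext r s
  rw [mul_apply]
  simp only [AddSubgroup.val_finsetSum, selfAdjoint.val_smul]
  rw [Matrix.sum_apply]
  apply Finset.sum_congr rfl
  intro i _
  simp [op_apply]
  ring

lemma Fr.sum {u : Fin n → Fin n → ℂ} (h : Fr u) : ∑ i, op (u i) = 1 := by
  apply Subtype.ext
  have := Fr.conj_diag (u := u) (fun _ => 1)
  simp only [one_smul] at this
  rw [this]
  have h2 := h.unitary
  rw [mem_unitaryGroup_iff] at h2
  rw [star_eq_conjTranspose] at h2
  simpa using h2

lemma spectral (X : BH n) : ∃ (u : Fin n → Fin n → ℂ) (c : Fin n → ℝ), Fr u ∧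
    X = ∑ i, c i • op (u i) := by
  have hX : (X : Matrix (Fin n) (Fin n) ℂ).IsHermitian := X.2
  refine ⟨fun i r => (hX.eigenvectorUnitary : Matrix (Fin n) (Fin n) ℂ) r i, hX.eigenvalues,
    Fr.of_unitary hX.eigenvectorUnitary.2, ?_⟩
  apply Subtype.ext
  rw [Fr.conj_diag]
  conv_lhs => rw [hX.spectral_theorem]
  rw [Unitary.conjStarAlgAut_apply]
  rfl

lemma exists_frame {v : Fin n → Fin n → ℂ} {s : Set (Fin n)}
    (hv : ∀ i ∈ s, ∀ j ∈ s, star (v i) ⬝ᵥ v j = if i = j then 1 else 0) :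
    ∃ u, Fr u ∧ ∀ i ∈ s, u i = v i := by
  have ho : Orthonormal ℂ (s.domRestrict (fun i => (WithLp.toLp 2 (v i) : EuclideanSpace ℂ (Fin n)))) := by
    rw [orthonormal_iff_ite]
    rintro ⟨i, hi⟩ ⟨j, hj⟩
    have := hv i hi j hj
    simp only [Subtype.mk.injEq]
    rw [← this]
    simp only [Set.domRestrict_apply, EuclideanSpace.inner_eq_star_dotProduct]
    rw [dotProduct_comm]
  obtain ⟨b, hb⟩ := ho.exists_orthonormalBasis_extension_of_card_eq (by simp)
  refine ⟨fun i => (b i).ofLp, ?_, fun i hi => by simp only [hb i hi]⟩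
  intro i j
  have := orthonormal_iff_ite.1 b.orthonormal i j
  rw [← this, EuclideanSpace.inner_eq_star_dotProduct, dotProduct_comm]

lemma exists_frame_one (i : Fin n) {a : Fin n → ℂ} (ha : star a ⬝ᵥ a = 1) :
    ∃ u, Fr u ∧ u i = a := by
  obtain ⟨u, hu, h⟩ := exists_frame (v := fun _ => a) (s := {i}) (by
    rintro _ rfl _ rfl; simpa using ha)
  exact ⟨u, hu, h i rfl⟩

lemma exists_frame_two {i j : Fin n} (hij : i ≠ j) {a x : Fin n → ℂ} (ha : star a ⬝ᵥ a = 1)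
    (hx : star x ⬝ᵥ x = 1) (hax : star a ⬝ᵥ x = 0) :
    ∃ u, Fr u ∧ u i = a ∧ u j = x := by
  have hxa : star x ⬝ᵥ a = 0 := by
    have := congrArg star hax
    rwa [star_dotProduct, star_star, star_zero] at this
  obtain ⟨u, hu, h⟩ := exists_frame (v := fun r => if r = i then a else x) (s := {i, j}) (by
    rintro r (rfl | rfl) s (rfl | rfl) <;> simp [ha, hx, hax, hxa, hij, hij.symm])
  exact ⟨u, hu, by simpa using h i (by simp), by simpa [hij.symm] using h j (by simp)⟩

lemma Fr.ip {u : Fin n → Fin n → ℂ} (h : Fr u) (i j) : ip (op (u i)) (op (u j)) = if i = j then 1 else 0 := by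
  rw [ip_op_op, h i j]; split_ifs <;> simp

lemma Fr.ip_sum {u : Fin n → Fin n → ℂ} (h : Fr u) (c : Fin n → ℝ) (j) :
    WF.ip (∑ i, c i • op (u i)) (op (u j)) = c j := by
  simp [h.ip]

lemma eq_zero_of_op {X : BH n} (h : ∀ v, star v ⬝ᵥ v = 1 → ip X (op v) = 0) : X = 0 := by
  obtain ⟨u, c, hu, rfl⟩ := spectral X
  have : ∀ j, c j = 0 := fun j => by rw [← hu.ip_sum c j]; exact h _ (hu.unit j)
  simp [this]

lemma ip_nondeg : (ip : LinearMap.BilinForm ℝ (BH n)).Nondegenerate := by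
  constructor
  · intro X h
    exact eq_zero_of_op fun v _ => h _
  · intro X h
    exact eq_zero_of_op fun v _ => by rw [ip_comm]; exact h _

instance : FiniteDimensional ℝ (BH n) :=
  Module.Finite.of_injective
    (⟨⟨fun X => (X : Matrix (Fin n) (Fin n) ℂ), fun _ _ => rfl⟩, fun _ _ => rfl⟩ :
      BH n →ₗ[ℝ] Matrix (Fin n) (Fin n) ℂ) Subtype.val_injective

lemma exists_adj (Φ : BH n →ₗ[ℝ] BH n) : ∃ Ψ : BH n →ₗ[ℝ] BH n, ∀ X Y, ip (Ψ X) Y = ip X (Φ Y) :=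
  ⟨_, LinearMap.BilinForm.isAdjointPairLeftAdjointOfNondegenerate _ ip_nondeg Φ⟩

lemma mem_projSet {k : ℕ} {P : BH n} : P ∈ projSet n k ↔
    (P : Matrix (Fin n) (Fin n) ℂ) * (P : Matrix (Fin n) (Fin n) ℂ) = P ∧ ip 1 P = k := by
  have key : ∀ M : Matrix (Fin n) (Fin n) ℂ, M * M = M → trace M = M.rank := by
    intro M hM
    have h1 : IsIdempotentElem (toLin' M) := by
      rw [IsIdempotentElem, Module.End.mul_eq_comp, ← toLin'_mul, hM]
    have := (LinearMap.IsIdempotentElem.isProj_range _ h1).trace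
    rw [trace_toLin'_eq] at this
    rw [this]; rfl
  constructor
  · rintro ⟨h1, h2⟩
    refine ⟨h1, ?_⟩
    rw [ip_one, key _ h1, h2]; simp
  · rintro ⟨h1, h2⟩
    refine ⟨h1, ?_⟩
    rw [ip_one, key _ h1] at h2
    simpa using h2

end WF

namespace WF

variable {n : ℕ}

lemma op_mul_op (u v : Fin n → ℂ) :
    (op u : Matrix (Fin n) (Fin n) ℂ) * (op v : Matrix (Fin n) (Fin n) ℂ) =
      (star u ⬝ᵥ v) • vecMulVec u (star v) := by
  rw [op_coe, op_coe, vecMulVec_mul_vecMulVec, vecMulVec_smul]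

lemma sum_mem {u : Fin n → Fin n → ℂ} (h : Fr u) {k : ℕ} (S : Finset (Fin n)) (hS : S.card = k) :
    ∑ i ∈ S, op (u i) ∈ projSet n k := by
  rw [mem_projSet]
  constructor
  · simp only [AddSubgroup.val_finsetSum]
    rw [Finset.sum_mul_sum]
    apply Finset.sum_congr rfl
    intro i hi
    simp only [op_mul_op, h i, ite_smul, one_smul, zero_smul]
    rw [Finset.sum_ite_eq, if_pos hi]
    rfl
  · rw [map_sum]
    simp [ip_one_op, h.unit, hS]

lemma idem_nonneg (a : Fin n → ℂ) {P : BH n}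
    (hP : (P : Matrix (Fin n) (Fin n) ℂ) * (P : Matrix (Fin n) (Fin n) ℂ) = P) :
    0 ≤ ip (op a) P := by
  rw [ip_comm, ip_op, ← hP]
  have h : (P : Matrix (Fin n) (Fin n) ℂ)ᴴ = P := P.2
  have h2 : star a ⬝ᵥ (((P : Matrix (Fin n) (Fin n) ℂ) * (P : Matrix (Fin n) (Fin n) ℂ)) *ᵥ a) =
      star ((P : Matrix (Fin n) (Fin n) ℂ) *ᵥ a) ⬝ᵥ ((P : Matrix (Fin n) (Fin n) ℂ) *ᵥ a) := by
    rw [star_mulVec, h, ← mulVec_mulVec, dotProduct_mulVec]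
  rw [h2]
  simp only [dotProduct, Complex.re_sum]
  apply Finset.sum_nonneg
  intro i _
  simp only [Pi.star_apply, Complex.star_def, ← Complex.normSq_eq_conj_mul_self]
  simpa using Complex.normSq_nonneg _

lemma proj_nonneg {k : ℕ} (a : Fin n → ℂ) {P : BH n} (hP : P ∈ projSet n k) : 0 ≤ ip (op a) P :=
  idem_nonneg a hP.1

lemma proj_le_one {k : ℕ} {a : Fin n → ℂ} (ha : star a ⬝ᵥ a = 1) {P : BH n}
    (hP : P ∈ projSet n k) : ip (op a) P ≤ 1 := by
  have := idem_nonneg a (P := 1 - P) (by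
    simp only [AddSubgroupClass.coe_sub, selfAdjoint.val_one]
    rw [sub_mul, mul_sub, mul_sub, hP.1]; simp)
  rw [map_sub, ip_comm, ip_one_op, ha] at this
  simp at this
  exact this

lemma compl_mem {k : ℕ} {P : BH n} (hP : P ∈ projSet n k) (hk : k ≤ n) : 1 - P ∈ projSet n (n - k) := by
  rw [mem_projSet] at *
  refine ⟨?_, ?_⟩
  · simp only [AddSubgroupClass.coe_sub, selfAdjoint.val_one]
    rw [sub_mul, mul_sub, mul_sub, hP.1]; simp
  · rw [map_sub, hP.2, ip_one]
    simp [Nat.cast_sub hk]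

lemma comb {y : Fin n → ℝ} {T : Finset (Fin n)} {k : ℕ} (hk : 1 ≤ k) (hkT : k < T.card)
    (h : ∀ S ⊆ T, S.card = k → ∑ i ∈ S, y i = 0) : ∀ i ∈ T, y i = 0 := by
  have heq : ∀ i ∈ T, ∀ j ∈ T, y i = y j := by
    intro i hi j hj
    by_cases hij : i = j
    · rw [hij]
    have hc : ((T.erase i).erase j).card = T.card - 1 - 1 := by
      rw [Finset.card_erase_of_mem (Finset.mem_erase.2 ⟨Ne.symm hij, hj⟩), Finset.card_erase_of_mem hi]
    obtain ⟨S, hS, hSc⟩ := Finset.exists_subset_card_eq (s := (T.erase i).erase j) (n := k - 1) (by omega)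
    have hiS : i ∉ S := fun h => by simpa using hS h
    have hjS : j ∉ S := fun h => by simpa using hS h
    have hST : S ⊆ T := hS.trans ((Finset.erase_subset _ _).trans (Finset.erase_subset _ _))
    have h1 := h (insert i S) (Finset.insert_subset hi hST) (by
      rw [Finset.card_insert_of_notMem hiS]; omega)
    have h2 := h (insert j S) (Finset.insert_subset hj hST) (by
      rw [Finset.card_insert_of_notMem hjS]; omega)
    rw [Finset.sum_insert hiS] at h1
    rw [Finset.sum_insert hjS] at h2
    linarith
  intro i hi
  obtain ⟨S, hS, hSc⟩ := Finset.exists_subset_card_eq (s := T) (n := k) (by omega)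
  have h1 := h S hS hSc
  rw [Finset.sum_congr rfl (fun j hj => heq j (hS hj) i hi), Finset.sum_const, hSc, nsmul_eq_mul] at h1
  have : (k : ℝ) ≠ 0 := by positivity
  simpa [this] using h1

lemma sep {k : ℕ} (hk : 1 ≤ k) (hkn : k < n) {Y : BH n} (h : ∀ P ∈ projSet n k, ip Y P = 0) : Y = 0 := by
  apply eq_zero_of_op
  intro v hv
  obtain ⟨u, hu, hu0⟩ := exists_frame_one (⟨0, by omega⟩ : Fin n) hv
  have := comb (y := fun i => ip Y (op (u i))) (T := Finset.univ) hk (by simpa using hkn) (by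
    intro S _ hS
    have := h _ (sum_mem hu S hS)
    rwa [map_sum] at this) ⟨0, by omega⟩ (Finset.mem_univ _)
  simpa [hu0] using this

/-- dual cone -/
def Kd (k : ℕ) (Y : BH n) : Prop := ∀ P ∈ projSet n k, 0 ≤ ip Y P

/-- An affine function that is nonnegative on the real line is constant. -/
lemma circ {A B : ℝ} (h : ∀ t : ℝ, 0 ≤ A + t * B) : B = 0 := by
  by_contra hB
  have := h (-(A + 1) / B)
  rw [div_mul_cancel₀ _ hB] at this
  linarith

end WF

namespace WF

variable {n : ℕ}

lemma op_smul (c : ℂ) (v : Fin n → ℂ) : op (c • v) = Complex.normSq c • op v := by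
  apply Subtype.ext
  ext i j
  simp only [selfAdjoint.val_smul, op_apply, Pi.smul_apply, Matrix.smul_apply, smul_eq_mul, star_mul',
    Complex.real_smul, ← Complex.mul_conj, Complex.star_def]
  ring

lemma op_add_smul (a x : Fin n → ℂ) (s : ℝ) :
    op (a + (s : ℂ) • x) = op a + s • (op (a + x) - op a - op x) + (s * s) • op x := by
  apply Subtype.ext
  ext i j
  simp [op_apply, Complex.real_smul]
  ring

lemma dot_self (r : Fin n → ℂ) : star r ⬝ᵥ r = ((∑ i, Complex.normSq (r i) : ℝ) : ℂ) := by
  simp [dotProduct, Complex.normSq_eq_conj_mul_self]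

lemma normalize {r : Fin n → ℂ} (hr : r ≠ 0) : ∃ (c : ℝ) (x : Fin n → ℂ), star x ⬝ᵥ x = 1 ∧ c ≠ 0 ∧
    r = (c : ℂ) • x := by
  have hpos : 0 < ∑ i, Complex.normSq (r i) := by
    obtain ⟨i, hi⟩ := Function.ne_iff.1 hr
    exact Finset.sum_pos' (fun _ _ => Complex.normSq_nonneg _) ⟨i, Finset.mem_univ _, Complex.normSq_pos.2 hi⟩
  have h := dot_self r
  set N := ∑ i, Complex.normSq (r i)
  have hs : (Real.sqrt N : ℂ) ≠ 0 := by
    exact_mod_cast (Real.sqrt_pos.2 hpos).ne'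
  have hss : (Real.sqrt N : ℂ) * (Real.sqrt N : ℂ) = (N : ℂ) := by
    exact_mod_cast Real.mul_self_sqrt hpos.le
  refine ⟨Real.sqrt N, ((Real.sqrt N : ℂ)⁻¹) • r, ?_, (Real.sqrt_pos.2 hpos).ne', ?_⟩
  · rw [star_smul, smul_dotProduct, dotProduct_smul, h, ← hss]
    simp only [Complex.star_def, smul_eq_mul, map_inv₀, Complex.conj_ofReal]
    field_simp
  · rw [smul_smul, mul_inv_cancel₀ hs, one_smul]

lemma extremal {k : ℕ} (hk : 1 ≤ k) (hkn : k + 2 ≤ n) {a : Fin n → ℂ} (ha : star a ⬝ᵥ a = 1)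
    {Y Z : BH n} (hY : Kd k Y) (hZ : Kd k Z) (h : op a = Y + Z) : ∃ t : ℝ, Y = t • op a := by
  obtain ⟨i0, i1, h01⟩ : ∃ i0 i1 : Fin n, i0 ≠ i1 :=
    ⟨⟨0, by omega⟩, ⟨1, by omega⟩, by simp⟩
  have hz : ∀ x, star x ⬝ᵥ x = 1 → star a ⬝ᵥ x = 0 → ip Y (op x) = 0 := by
    intro x hx hax
    obtain ⟨u, hu, hu0, hu1⟩ := exists_frame_two h01 ha hx hax
    have := comb (y := fun i => ip Y (op (u i))) (T := Finset.univ.erase i0) hk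
      (by simp; omega) (by
      intro S hST hS
      have hm := sum_mem hu S hS
      have h0 : ip (op a) (∑ i ∈ S, op (u i)) = 0 := by
        rw [map_sum]
        apply Finset.sum_eq_zero
        intro i hi
        rw [← hu0, hu.ip, if_neg]
        rintro rfl
        simpa using hST hi
      have h1 := hY _ hm
      have h2 := hZ _ hm
      rw [h, map_add, LinearMap.add_apply] at h0
      rw [← map_sum]
      linarith) i1 (by simp [h01.symm])
    simpa [hu1] using this
  have hz' : ∀ x, star a ⬝ᵥ x = 0 → ip Y (op x) = 0 := by
    intro x hax
    by_cases hx : x = 0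
    · subst hx
      have : op (0 : Fin n → ℂ) = 0 := by
        have := op_smul 0 (0 : Fin n → ℂ)
        simpa using this
      rw [this]; simp
    · obtain ⟨c, y, hy, hc, rfl⟩ := normalize hx
      rw [op_smul, map_smul, hz y hy, smul_zero]
      rw [dotProduct_smul, smul_eq_mul] at hax
      have : (c : ℂ) ≠ 0 := by exact_mod_cast hc
      simpa [this] using hax

  have hpos1 : ∀ v, star v ⬝ᵥ v = 1 → 0 ≤ ip Y (op v) := by
    intro v hv
    have key : ∃ u, Fr u ∧ u i0 = v ∧ ∀ i, i ≠ i0 → i ≠ i1 → star a ⬝ᵥ u i = 0 := by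
      by_cases hr : a - (star v ⬝ᵥ a) • v = 0
      · obtain ⟨u, hu, hu0⟩ := exists_frame_one i0 hv
        refine ⟨u, hu, hu0, ?_⟩
        intro i hi _
        rw [sub_eq_zero] at hr
        rw [hr, ← hu0, star_smul, smul_dotProduct, hu, if_neg (Ne.symm hi), smul_zero]
      · obtain ⟨c, x, hx, hc, hcx⟩ := normalize hr
        have hc' : (c : ℂ) ≠ 0 := by exact_mod_cast hc
        have hvx : star v ⬝ᵥ x = 0 := by
          have : star v ⬝ᵥ ((c : ℂ) • x) = 0 := by
            rw [← hcx, dotProduct_sub, dotProduct_smul, hv]; simp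
          rw [dotProduct_smul, smul_eq_mul] at this
          simpa [hc'] using this
        obtain ⟨u, hu, hu0, hu1⟩ := exists_frame_two h01 hv hx hvx
        refine ⟨u, hu, hu0, ?_⟩
        intro i hi0 hi1
        have : a = (star v ⬝ᵥ a) • u i0 + (c : ℂ) • u i1 := by
          rw [hu0, hu1, ← hcx]; simp
        rw [this, star_add, star_smul, star_smul, add_dotProduct, smul_dotProduct, smul_dotProduct,
          hu, hu, if_neg (Ne.symm hi0), if_neg (Ne.symm hi1)]
        simp
    obtain ⟨u, hu, hu0, hui⟩ := key
    have hc : ((Finset.univ.erase i0).erase i1).card = n - 1 - 1 := by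
      rw [Finset.card_erase_of_mem (Finset.mem_erase.2 ⟨Ne.symm h01, Finset.mem_univ _⟩),
        Finset.card_erase_of_mem (Finset.mem_univ _)]; simp
    obtain ⟨S, hS, hSc⟩ := Finset.exists_subset_card_eq (s := (Finset.univ.erase i0).erase i1) (n := k - 1) (by omega)
    have hiS : i0 ∉ S := fun h => by simpa using hS h
    have := hY _ (sum_mem hu (insert i0 S) (k := k) (by
      rw [Finset.card_insert_of_notMem hiS]; omega))
    rw [Finset.sum_insert hiS, map_add, map_sum, Finset.sum_eq_zero, hu0, add_zero] at this
    · exact this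
    · intro i hi
      have := hS hi
      simp at this
      exact hz' _ (hui i this.2 this.1)
  have hpos : ∀ v, 0 ≤ ip Y (op v) := by
    intro v
    by_cases hv : v = 0
    · rw [hz' v (by simp [hv])]
    · obtain ⟨c, x, hx, _, rfl⟩ := normalize hv
      rw [op_smul, map_smul]
      exact mul_nonneg (Complex.normSq_nonneg _) (hpos1 x hx)
  have hcross : ∀ x, star a ⬝ᵥ x = 0 → ip Y (op (a + x)) = ip Y (op a) := by
    intro x hx
    have := circ (A := ip Y (op a)) (B := ip Y (op (a + x)) - ip Y (op a)) (by
      intro t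
      have := hpos (a + (t : ℂ) • x)
      rw [op_add_smul] at this
      simpa [hz' x hx] using this)
    linarith
  refine ⟨ip Y (op a), ?_⟩
  rw [← sub_eq_zero]
  apply eq_zero_of_op
  intro v _
  rw [map_sub, map_smul, LinearMap.sub_apply, LinearMap.smul_apply, ip_op_op, smul_eq_mul, sub_eq_zero]
  set α := star a ⬝ᵥ v with hα
  have hx : star a ⬝ᵥ (v - α • a) = 0 := by
    rw [dotProduct_sub, dotProduct_smul, ha, ← hα]; simp
  by_cases h0 : α = 0
  · rw [h0] at hx
    simp at hx
    rw [hz' v hx, h0]; simp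
  · have : v = α • (a + α⁻¹ • (v - α • a)) := by
      rw [smul_add, smul_smul, mul_inv_cancel₀ h0, one_smul]; simp
    rw [this, op_smul, map_smul, hcross, smul_eq_mul, mul_comm]
    rw [dotProduct_smul, hx, smul_zero]

end WF

namespace WF

variable {n : ℕ}

lemma threshold {k : ℕ} (hk : 1 ≤ k) (hkn : k ≤ n) (y : Fin n → ℝ) : ∃ (S : Finset (Fin n)) (τ : ℝ),
    S.card = k ∧ (∀ i ∈ S, y i ≤ τ) ∧ ∀ i ∉ S, τ ≤ y i := by
  obtain ⟨S, hS, hmin⟩ := Finset.exists_min_image (Finset.powersetCard k (Finset.univ : Finset (Fin n)))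
    (fun S => ∑ i ∈ S, y i) (Finset.powersetCard_nonempty.2 (by simpa using hkn))
  rw [Finset.mem_powersetCard] at hS
  have hne : S.Nonempty := Finset.card_pos.1 (by omega)
  obtain ⟨m, hm, hmax⟩ := Finset.exists_max_image S y hne
  refine ⟨S, y m, hS.2, hmax, ?_⟩
  intro i hi
  have hi' : i ∉ S.erase m := fun h => hi (Finset.mem_of_mem_erase h)
  have := hmin (insert i (S.erase m)) (by
    rw [Finset.mem_powersetCard]
    refine ⟨Finset.subset_univ _, ?_⟩
    rw [Finset.card_insert_of_notMem hi', Finset.card_erase_of_mem hm]; omega)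
  rw [Finset.sum_insert hi', ← Finset.add_sum_erase S y hm] at this
  linarith

/-- second kind of generator -/
def co (k : ℕ) (b : Fin n → ℂ) : BH n := (k : ℝ)⁻¹ • (1 : BH n) - op b

lemma ip_co {k : ℕ} (hk : 1 ≤ k) (b : Fin n → ℂ) {P : BH n} (hP : P ∈ projSet n k) :
    ip (co k b) P = 1 - ip (op b) P := by
  have : (k : ℝ) ≠ 0 := by positivity
  rw [co, map_sub, map_smul, LinearMap.sub_apply, LinearMap.smul_apply, (mem_projSet.1 hP).2]
  simp [this]

lemma ip_one_one : ip (1 : BH n) 1 = n := by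
  rw [ip_one]; simp

/-- A generator of the dual cone -/
def Gen (k : ℕ) (g : BH n) : Prop := ∃ b, star b ⬝ᵥ b = 1 ∧ (g = op b ∨ g = co k b)

lemma Gen.bd {k : ℕ} (hk : 1 ≤ k) {g : BH n} (hg : Gen k g) {P : BH n} (hP : P ∈ projSet n k) :
    0 ≤ ip g P ∧ ip g P ≤ 1 := by
  obtain ⟨b, hb, rfl | rfl⟩ := hg
  · exact ⟨proj_nonneg b hP, proj_le_one hb hP⟩
  · rw [ip_co hk b hP]
    have := proj_nonneg b hP
    have := proj_le_one hb hP
    constructor <;> linarith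

lemma op_attain {k : ℕ} (hk : 1 ≤ k) (hkn : k < n) {b : Fin n → ℂ} (hb : star b ⬝ᵥ b = 1) :
    (∃ P ∈ projSet n k, ip (op b) P = 1) ∧ (∃ P ∈ projSet n k, ip (op b) P = 0) := by
  let i0 : Fin n := ⟨0, by omega⟩
  obtain ⟨u, hu, hu0⟩ := exists_frame_one i0 hb
  constructor
  · obtain ⟨S, hS, hSc⟩ := Finset.exists_subset_card_eq (s := Finset.univ.erase i0) (n := k - 1) (by simp; omega)
    have hi : i0 ∉ S := fun h => by simpa using hS h
    refine ⟨_, sum_mem hu (insert i0 S) (by rw [Finset.card_insert_of_notMem hi]; omega), ?_⟩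
    rw [map_sum, ← hu0]
    simp [hu.ip]
  · obtain ⟨S, hS, hSc⟩ := Finset.exists_subset_card_eq (s := Finset.univ.erase i0) (n := k) (by simp; omega)
    have hi : i0 ∉ S := fun h => by simpa using hS h
    refine ⟨_, sum_mem hu S hSc, ?_⟩
    rw [map_sum, ← hu0]
    simp [hu.ip, hi]

lemma Gen.attain {k : ℕ} (hk : 1 ≤ k) (hkn : k < n) {g : BH n} (hg : Gen k g) :
    ∃ P ∈ projSet n k, ip g P = 1 := by
  obtain ⟨b, hb, rfl | rfl⟩ := hg
  · exact (op_attain hk hkn hb).1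
  · obtain ⟨P, hP, h⟩ := (op_attain hk hkn hb).2
    exact ⟨P, hP, by rw [ip_co hk b hP, h, sub_zero]⟩

lemma decomp {k : ℕ} (hk : 1 ≤ k) (hkn : k ≤ n) {Y : BH n} (hY : Kd k Y) :
    ∃ (c : Fin n ⊕ Fin n → ℝ) (g : Fin n ⊕ Fin n → BH n), (∀ i, 0 ≤ c i) ∧ (∀ i, Gen k (g i)) ∧
      Y = ∑ i, c i • g i := by
  obtain ⟨u, y, hu, rfl⟩ := spectral Y
  obtain ⟨S, τ, hS, h1, h2⟩ := threshold hk hkn y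
  have hk0 : (k : ℝ) ≠ 0 := by positivity
  let m : Fin n → ℝ := fun i => max (τ - y i) 0
  let p : Fin n → ℝ := fun i => max (y i - τ) 0
  have hmp : ∀ i, y i = τ + p i - m i := by
    intro i
    simp only [m, p]
    rcases le_total (y i) τ with h | h
    · rw [max_eq_right (by linarith), max_eq_left (by linarith)]; ring
    · rw [max_eq_left (by linarith), max_eq_right (by linarith)]; ring
  have hm : ∑ i, m i = k * τ - ∑ i ∈ S, y i := by
    rw [← Finset.sum_subset (Finset.subset_univ S)]
    · rw [Finset.sum_congr rfl (g := fun i => τ - y i), Finset.sum_sub_distrib, Finset.sum_const, hS, nsmul_eq_mul]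
      intro i hi
      exact max_eq_left (by linarith [h1 i hi])
    · intro i _ hi
      exact max_eq_right (by linarith [h2 i hi])
  have hm0 : ∑ i, m i ≤ k * τ := by
    have := hY _ (sum_mem hu S hS)
    rw [map_sum, Finset.sum_congr rfl (fun j _ => hu.ip_sum y j)] at this
    linarith
  let e : ℝ := τ - (k : ℝ)⁻¹ * ∑ i, m i
  have he : 0 ≤ e := by
    have : (k : ℝ)⁻¹ * ∑ i, m i ≤ (k : ℝ)⁻¹ * (k * τ) := mul_le_mul_of_nonneg_left hm0 (by positivity)
    rw [← mul_assoc, inv_mul_cancel₀ hk0, one_mul] at this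
    simp only [e]; linarith
  refine ⟨Sum.elim (fun i => p i + e) m, Sum.elim (fun i => op (u i)) (fun i => co k (u i)), ?_, ?_, ?_⟩
  · rintro (i | i)
    · exact add_nonneg (le_max_right _ _) he
    · exact le_max_right _ _
  · rintro (i | i)
    · exact ⟨u i, hu.unit i, Or.inl rfl⟩
    · exact ⟨u i, hu.unit i, Or.inr rfl⟩
  · rw [Fintype.sum_sum_type]
    simp only [Sum.elim_inl, Sum.elim_inr, co, smul_sub, Finset.sum_sub_distrib, add_smul, Finset.sum_add_distrib]
    rw [← Finset.smul_sum, hu.sum, ← Finset.sum_smul, smul_smul]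
    have : ∀ i, y i • op (u i) = τ • op (u i) + p i • op (u i) - m i • op (u i) := by
      intro i
      rw [hmp i, sub_smul, add_smul]
    simp only [this, Finset.sum_sub_distrib, Finset.sum_add_distrib]
    rw [← Finset.smul_sum, hu.sum]
    simp only [e, sub_smul]
    rw [mul_comm (∑ i, m i)]
    abel

lemma Gen.Kd {k : ℕ} (hk : 1 ≤ k) {g : BH n} (hg : Gen k g) : Kd k g := fun _ hP => (hg.bd hk hP).1

lemma gen_map {k : ℕ} (hk : 1 ≤ k) (hkn : k + 2 ≤ n) {Φ Ψ : BH n →ₗ[ℝ] BH n}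
    (hΦ : (⇑Φ) '' projSet n k = projSet n k) (hadj : ∀ X Y, ip (Ψ X) Y = ip X (Φ Y))
    {a : Fin n → ℂ} (ha : star a ⬝ᵥ a = 1) : Gen k (Ψ (op a)) := by
  have hmap : ∀ P ∈ projSet n k, Φ P ∈ projSet n k := fun P hP => hΦ ▸ Set.mem_image_of_mem _ hP
  have hsur : ∀ P ∈ projSet n k, ∃ Q ∈ projSet n k, Φ Q = P := fun P hP => by
    rw [← hΦ] at hP; exact hP
  have hinj : Function.Injective Ψ := by
    rw [injective_iff_map_eq_zero]
    intro X hX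
    apply sep hk (by omega : k < n)
    intro P hP
    obtain ⟨Q, _, rfl⟩ := hsur P hP
    rw [← hadj, hX]; simp
  have hsurj : Function.Surjective Ψ := LinearMap.injective_iff_surjective.1 hinj
  have hKinv : ∀ Y, Kd k (Ψ Y) → Kd k Y := by
    intro Y h P hP
    obtain ⟨Q, hQ, rfl⟩ := hsur P hP
    rw [← hadj]; exact h Q hQ
  have hK : Kd k (Ψ (op a)) := by
    intro P hP
    rw [hadj]; exact proj_nonneg a (hmap P hP)
  obtain ⟨c, g, hc, hg, hsum⟩ := decomp hk (by omega) hK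
  choose g' hg' using fun i => hsurj (g i)
  have hsum' : op a = ∑ i, c i • g' i := by
    apply hinj
    rw [hsum, map_sum]
    simp [hg']
  have hKg : ∀ i, Kd k (c i • g' i) := by
    intro i P hP
    have := hKinv (g' i) (by rw [hg']; exact (hg i).Kd hk) P hP
    simpa using mul_nonneg (hc i) this
  obtain ⟨P1, hP1, hP1'⟩ := (op_attain hk (by omega : k < n) ha).1
  obtain ⟨i, hi⟩ : ∃ i, c i ≠ 0 := by
    by_contra! h
    rw [hsum'] at hP1'
    simp [h] at hP1'
  obtain ⟨t, ht⟩ := extremal hk hkn ha (hKg i) (Z := ∑ j ∈ Finset.univ.erase i, c j • g' j) (by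
      intro P hP
      rw [map_sum, LinearMap.sum_apply]
      exact Finset.sum_nonneg fun j _ => hKg j P hP) (by
      rw [hsum']; exact (Finset.add_sum_erase _ (fun j => c j • g' j) (Finset.mem_univ i)).symm)
  have ht' : c i • g i = t • Ψ (op a) := by
    rw [← map_smul, ← ht, map_smul, hg']
  obtain ⟨P2, hP2, hP2'⟩ := (hg i).attain hk (by omega)
  have e2 : c i = t * ip (op a) (Φ P2) := by
    have := congrArg (fun X => ip X P2) ht'
    simpa [hadj, hP2'] using this
  obtain ⟨Q, hQ, rfl⟩ := hsur P1 hP1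
  have e1 : c i * ip (g i) Q = t := by
    have := congrArg (fun X => ip X Q) ht'
    simpa [hadj, hP1'] using this
  have b1 := (hg i).bd hk hQ
  have b2 := proj_nonneg a (hmap _ hP2)
  have b3 := proj_le_one ha (hmap _ hP2)
  have hci : 0 < c i := lt_of_le_of_ne (hc i) (Ne.symm hi)
  have hct : c i = t := by
    apply le_antisymm
    · have : 0 ≤ t := by rw [← e1]; exact mul_nonneg hci.le b1.1
      nlinarith
    · nlinarith
  have : Ψ (op a) = g i := by
    rw [← hct] at ht'
    exact (smul_right_injective _ hi ht').symm
  rw [this]; exact hg i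

lemma rank_one_map {k : ℕ} (hk : 1 ≤ k) (hkn : k + 2 ≤ n) (h2k : 2 * k < n) {Φ Ψ : BH n →ₗ[ℝ] BH n}
    (hΦ : (⇑Φ) '' projSet n k = projSet n k) (hadj : ∀ X Y, ip (Ψ X) Y = ip X (Φ Y)) :
    Ψ 1 = 1 ∧ ∀ a, star a ⬝ᵥ a = 1 → ∃ b, star b ⬝ᵥ b = 1 ∧ Ψ (op a) = op b := by
  have hmap : ∀ P ∈ projSet n k, Φ P ∈ projSet n k := fun P hP => hΦ ▸ Set.mem_image_of_mem _ hP
  have h1 : Ψ 1 = 1 := by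
    rw [← sub_eq_zero]
    apply sep hk (by omega : k < n)
    intro P hP
    rw [map_sub, LinearMap.sub_apply, hadj, (mem_projSet.1 hP).2, (mem_projSet.1 (hmap P hP)).2, sub_self]
  refine ⟨h1, ?_⟩
  intro a ha
  let i0 : Fin n := ⟨0, by omega⟩
  obtain ⟨u, hu, hu0⟩ := exists_frame_one i0 ha
  have hk0 : (0 : ℝ) < k := by exact_mod_cast hk
  have hco : ∀ b : Fin n → ℂ, star b ⬝ᵥ b = 1 → 1 < ip 1 (co k b) := by
    intro b hb
    rw [co, map_sub, map_smul, ip_one_one, ip_one_op, hb, smul_eq_mul]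
    have : (2 : ℝ) < (k : ℝ)⁻¹ * n := by
      rw [inv_mul_eq_div, lt_div_iff₀ hk0]
      exact_mod_cast h2k
    simp; linarith
  have hge : ∀ i, 1 ≤ ip 1 (Ψ (op (u i))) := by
    intro i
    obtain ⟨b, hb, h | h⟩ := gen_map hk hkn hΦ hadj (hu.unit i)
    · rw [h, ip_one_op, hb]; simp
    · rw [h]; exact (hco b hb).le
  have hs : ∑ i, ip 1 (Ψ (op (u i))) = n := by
    rw [← map_sum, ← map_sum, hu.sum, h1, ip_one_one]
  obtain ⟨b, hb, h | h⟩ := gen_map hk hkn hΦ hadj ha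
  · exact ⟨b, hb, h⟩
  · exfalso
    have : ∑ i : Fin n, (1 : ℝ) < ∑ i, ip 1 (Ψ (op (u i))) :=
      Finset.sum_lt_sum (fun i _ => hge i) ⟨i0, Finset.mem_univ _, by
        rw [hu0, h]; exact hco b hb⟩
    rw [hs] at this
    simp at this

end WF

namespace WF

variable {n : ℕ}

lemma herm_apply (X : BH n) (i j : Fin n) :
    (X : Matrix (Fin n) (Fin n) ℂ) j i = star ((X : Matrix (Fin n) (Fin n) ℂ) i j) := by
  have h : (X : Matrix (Fin n) (Fin n) ℂ)ᴴ = X := X.2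
  conv_lhs => rw [← h]
  rfl

lemma herm_im (X : BH n) (i : Fin n) : ((X : Matrix (Fin n) (Fin n) ℂ) i i).im = 0 := by
  have := (herm_apply X i i).symm
  exact Complex.conj_eq_iff_im.1 this

lemma ip_two (Z : BH n) {i j : Fin n} (hij : i ≠ j) {w : Fin n → ℂ} (hw : ∀ r, r ≠ i → r ≠ j → w r = 0) :
    ip Z (op w) = Complex.normSq (w i) * ((Z : Matrix (Fin n) (Fin n) ℂ) i i).re +
      Complex.normSq (w j) * ((Z : Matrix (Fin n) (Fin n) ℂ) j j).re +
      2 * ((Z : Matrix (Fin n) (Fin n) ℂ) i j * (w j * star (w i))).re := by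
  have hs : ∀ f : Fin n → ℂ, (∀ r, r ≠ i → r ≠ j → f r = 0) → ∑ r, f r = f i + f j := by
    intro f hf
    rw [← Finset.sum_pair hij]
    symm
    apply Finset.sum_subset (Finset.subset_univ _)
    intro r _ hr
    simp only [Finset.mem_insert, Finset.mem_singleton, not_or] at hr
    exact hf r hr.1 hr.2
  rw [ip_op]
  simp only [dotProduct, mulVec]
  rw [hs _ (fun r h1 h2 => by simp [hw r h1 h2]), hs _ (fun r h1 h2 => by simp [hw r h1 h2]),
    hs _ (fun r h1 h2 => by simp [hw r h1 h2]), herm_apply Z i j]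
  have h1 := herm_im Z i
  have h2 := herm_im Z j
  simp [Complex.normSq_apply, h1, h2]
  ring

lemma op_single_apply (i : Fin n) (Z : BH n) :
    ip Z (op (Pi.single i 1)) = ((Z : Matrix (Fin n) (Fin n) ℂ) i i).re := by
  rw [ip_op]
  simp [dotProduct, mulVec, Pi.single_apply]

lemma wigner_normalized {Ψ : BH n →ₗ[ℝ] BH n} (hiso : ∀ X Y, ip (Ψ X) (Ψ Y) = ip X Y)
    (hr : ∀ v, ∃ w, Ψ (op v) = op w) (he : ∀ i, Ψ (op (Pi.single i 1)) = op (Pi.single i 1))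
    (h1 : Ψ (op 1) = op 1) :
    (∀ X : BH n, (Ψ X : Matrix (Fin n) (Fin n) ℂ) = X) ∨
    (∀ X : BH n, (Ψ X : Matrix (Fin n) (Fin n) ℂ) = (X : Matrix (Fin n) (Fin n) ℂ)ᵀ) := by
  have hdre : ∀ (X : BH n) i, ((Ψ X : Matrix (Fin n) (Fin n) ℂ) i i).re = ((X : Matrix (Fin n) (Fin n) ℂ) i i).re := by
    intro X i
    rw [← op_single_apply, ← op_single_apply, ← hiso X, he]
  have hd : ∀ (X : BH n) i, (Ψ X : Matrix (Fin n) (Fin n) ℂ) i i = (X : Matrix (Fin n) (Fin n) ℂ) i i := by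
    intro X i
    apply Complex.ext (hdre X i)
    rw [herm_im, herm_im]
  have hns : ∀ v w, Ψ (op v) = op w → ∀ r, Complex.normSq (w r) = Complex.normSq (v r) := by
    intro v w h r
    have := hdre (op v) r
    rw [h, op_apply, op_apply, Complex.star_def, Complex.mul_conj, Complex.mul_conj] at this
    simpa using this
  have two : ∀ i j, i ≠ j → ∀ v : Fin n → ℂ, (∀ r, r ≠ i → r ≠ j → v r = 0) → ∃ z : ℂ,
      Complex.normSq z = Complex.normSq (v i) * Complex.normSq (v j) ∧
      ∀ X : BH n, ((Ψ X : Matrix (Fin n) (Fin n) ℂ) i j * z).re =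
        ((X : Matrix (Fin n) (Fin n) ℂ) i j * (v j * star (v i))).re := by
    intro i j hij v hv
    obtain ⟨w, hw⟩ := hr v
    have hn := hns v w hw
    refine ⟨w j * star (w i), ?_, ?_⟩
    · rw [Complex.normSq_mul, Complex.star_def, Complex.normSq_conj, hn, hn, mul_comm]
    intro X
    have h := hiso X (op v)
    rw [hw, ip_two _ hij (fun r h1 h2 => Complex.normSq_eq_zero.1 (by rw [hn, hv r h1 h2]; simp)),
      ip_two _ hij hv, hn, hn, hdre, hdre] at h
    linarith
  have hJ : ∀ i j, (Ψ (op 1) : Matrix (Fin n) (Fin n) ℂ) i j = 1 := by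
    intro i j
    rw [h1, op_apply]; simp
  have hJ' : ∀ i j, (op 1 : BH n).1 i j = 1 := by
    intro i j
    rw [op_apply]; simp
  have hre : ∀ (X : BH n) i j, ((Ψ X : Matrix (Fin n) (Fin n) ℂ) i j).re = ((X : Matrix (Fin n) (Fin n) ℂ) i j).re := by
    intro X i j
    by_cases hij : i = j
    · rw [hij, hdre]
    obtain ⟨z, hz, h⟩ := two i j hij (fun r => if r = i then 1 else if r = j then 1 else 0)
      (fun r h1 h2 => by simp [h1, h2])
    have hz1 := h (op 1)
    rw [hJ, hJ'] at hz1
    simp [Ne.symm hij] at hz hz1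
    rw [Complex.normSq_apply, hz1] at hz
    have him : z.im = 0 := by nlinarith
    have : z = 1 := Complex.ext hz1 him
    have h2 := h X
    rw [this] at h2
    simpa [Ne.symm hij] using h2
  have him : ∀ i j, i ≠ j → ∃ ε : ℝ, (ε = 1 ∨ ε = -1) ∧ ∀ X : BH n,
      ((Ψ X : Matrix (Fin n) (Fin n) ℂ) i j).im = ε * ((X : Matrix (Fin n) (Fin n) ℂ) i j).im := by
    intro i j hij
    obtain ⟨z, hz, h⟩ := two i j hij (fun r => if r = i then Complex.I else if r = j then 1 else 0)
      (fun r h1 h2 => by simp [h1, h2])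
    have hz1 := h (op 1)
    rw [hJ, hJ'] at hz1
    simp [Ne.symm hij] at hz hz1
    rw [Complex.normSq_apply, hz1] at hz
    have hi2 : z.im * z.im = 1 := by linarith
    refine ⟨-z.im, ?_, ?_⟩
    · rcases mul_self_eq_one_iff.1 hi2 with h | h
      · right; rw [h]
      · left; rw [h]; simp
    · intro X
      have h2 := h X
      simp [Ne.symm hij, hz1] at h2
      rw [← h2]
      linear_combination (-((Ψ X : Matrix (Fin n) (Fin n) ℂ) i j).im) * hi2
  choose! ε hε hεX using him
  have hsymm : ∀ i j, i ≠ j → ε i j = ε j i := by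
    intro i j hij
    let X : BH n := op (fun r => if r = i then Complex.I else 1)
    have a1 := hεX i j hij X
    have a2 := hεX j i hij.symm X
    rw [herm_apply (Ψ X) i j] at a2
    simp [X, op_apply, hij.symm] at a1 a2
    linarith
  have hrow : ∀ i j k, i ≠ j → i ≠ k → ε i j = ε i k := by
    intro i j k hij hik
    by_cases hjk : j = k
    · rw [hjk]
    set v : Fin n → ℂ := fun r => if r = i then Complex.I else 1 with hv
    obtain ⟨w, hw⟩ := hr v
    have hwj := hns v w hw j
    have a1 := hεX i j hij (op v)
    have a2 := hεX i k hik (op v)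
    have b1 := hre (op v) i j
    have b2 := hre (op v) j k
    have b3 := hre (op v) i k
    have a3 := hεX j k hjk (op v)
    rw [hw] at a1 a2 b1 b2 b3 a3
    simp only [op_apply] at a1 a2 b1 b2 b3 a3
    have hmul : (w i * star (w j)) * (w j * star (w k)) = w i * star (w k) := by
      have : star (w j) * w j = 1 := by
        rw [Complex.star_def, ← Complex.normSq_eq_conj_mul_self, hwj]
        simp [hv, hij.symm]
      linear_combination (w i * star (w k)) * this
    have c1 : w j * star (w k) = 1 := by
      apply Complex.ext
      · rw [b2]; simp [hv, hij.symm, hik.symm]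
      · rw [a3]; simp [hv, hij.symm, hik.symm]
    rw [c1, mul_one] at hmul
    rw [hmul, a2] at a1
    simp [hv, hij.symm, hik.symm] at a1
    exact a1.symm
  have hall : ∀ i j k l, i ≠ j → k ≠ l → ε i j = ε k l := by
    intro i j k l hij hkl
    by_cases hik : i = k
    · subst hik; exact hrow i j l hij hkl
    · rw [hrow i j k hij hik, hsymm i k hik, hrow k i l (Ne.symm hik) hkl]
  have hfin : ∀ e : ℝ, (∀ i j, i ≠ j → ε i j = e) → ∀ X : BH n, ∀ i j,
      (Ψ X : Matrix (Fin n) (Fin n) ℂ) i j = ⟨((X : Matrix (Fin n) (Fin n) ℂ) i j).re, e * ((X : Matrix (Fin n) (Fin n) ℂ) i j).im⟩ := by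
    intro e he X i j
    refine Complex.ext (by rw [hre X i j]) ?_
    by_cases hij : i = j
    · subst hij; simp [herm_im]
    · rw [hεX i j hij, he i j hij]
  by_cases hex : ∃ i j : Fin n, i ≠ j ∧ ε i j = -1
  · right
    obtain ⟨i, j, hij, h⟩ := hex
    intro X
    ext r s
    rw [hfin (-1) (fun k l hkl => by rw [← h]; exact hall _ _ _ _ hkl hij), transpose_apply, herm_apply X r s]
    apply Complex.ext <;> simp
  · left
    push Not at hex
    intro X
    ext r s
    rw [hfin 1 (fun k l hkl => (hε k l hkl).resolve_right (hex k l hkl))]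
    apply Complex.ext <;> simp

end WF

namespace WF

variable {n : ℕ}

/-- conjugation -/
def cj (V : Matrix (Fin n) (Fin n) ℂ) : BH n →ₗ[ℝ] BH n where
  toFun X := ⟨V * (X : Matrix (Fin n) (Fin n) ℂ) * Vᴴ, by
    have h : (X : Matrix (Fin n) (Fin n) ℂ)ᴴ = X := X.2
    rw [selfAdjoint.mem_iff, star_eq_conjTranspose]
    simp [conjTranspose_mul, h, mul_assoc]⟩
  map_add' X Y := Subtype.ext (by simp [mul_add, add_mul])
  map_smul' c X := Subtype.ext (by simp)

lemma cj_coe (V : Matrix (Fin n) (Fin n) ℂ) (X : BH n) :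
    (cj V X : Matrix (Fin n) (Fin n) ℂ) = V * (X : Matrix (Fin n) (Fin n) ℂ) * Vᴴ := rfl

lemma cj_op (V : Matrix (Fin n) (Fin n) ℂ) (v : Fin n → ℂ) : cj V (op v) = op (V *ᵥ v) := by
  apply Subtype.ext
  rw [cj_coe, op_coe, op_coe, mul_vecMulVec, vecMulVec_mul, star_mulVec]

lemma cj_ip {V : Matrix (Fin n) (Fin n) ℂ} (hV : Vᴴ * V = 1) (X Y : BH n) :
    ip (cj V X) (cj V Y) = ip X Y := by
  rw [ip_def, ip_def, cj_coe, cj_coe]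
  have : V * (X : Matrix (Fin n) (Fin n) ℂ) * Vᴴ * (V * (Y : Matrix (Fin n) (Fin n) ℂ) * Vᴴ) =
      V * ((X : Matrix (Fin n) (Fin n) ℂ) * (Vᴴ * V) * (Y : Matrix (Fin n) (Fin n) ℂ)) * Vᴴ := by
    simp only [mul_assoc]
  rw [this, hV, mul_one, trace_mul_comm, ← mul_assoc, hV, one_mul]

lemma frame_map {Ψ : BH n →ₗ[ℝ] BH n} (h1 : Ψ 1 = 1) {u w : Fin n → Fin n → ℂ} (hu : Fr u)
    (hw : ∀ i, star (w i) ⬝ᵥ w i = 1) (h : ∀ i, Ψ (op (u i)) = op (w i)) : Fr w := by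
  have hs : ∑ i, op (w i) = 1 := by
    rw [← h1, ← hu.sum, map_sum]; simp [h]
  intro i j
  by_cases hij : i = j
  · subst hij; simp [hw]
  rw [if_neg hij]
  have h2 : ip (op (w i)) (∑ l, op (w l)) = 1 := by
    rw [hs, ip_comm, ip_one_op, hw]; simp
  rw [map_sum, ← Finset.add_sum_erase _ _ (Finset.mem_univ i), ip_op_op, hw] at h2
  simp only [Complex.normSq_one, ip_op_op] at h2
  have h3 : ∑ l ∈ Finset.univ.erase i, Complex.normSq (star (w i) ⬝ᵥ w l) = 0 := by linarith
  rw [Finset.sum_eq_zero_iff_of_nonneg (fun _ _ => Complex.normSq_nonneg _)] at h3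
  exact Complex.normSq_eq_zero.1 (h3 j (by simp [Ne.symm hij]))

lemma wigner {Ψ : BH n →ₗ[ℝ] BH n} (h1 : Ψ 1 = 1)
    (hr : ∀ a, star a ⬝ᵥ a = 1 → ∃ b, star b ⬝ᵥ b = 1 ∧ Ψ (op a) = op b) : WignerForm n Ψ := by
  have hiso1 : ∀ X, ip (Ψ X) (Ψ X) = ip X X := by
    intro X
    obtain ⟨u, c, hu, rfl⟩ := spectral X
    choose w hw hw2 using fun i => hr (u i) (hu.unit i)
    have hF := frame_map h1 hu hw hw2
    simp [map_sum, hw2, hF.ip, hu.ip]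
  have hiso : ∀ X Y, ip (Ψ X) (Ψ Y) = ip X Y := by
    intro X Y
    have a1 := hiso1 (X + Y)
    have a2 := hiso1 X
    have a3 := hiso1 Y
    simp only [map_add, LinearMap.add_apply] at a1
    rw [ip_comm (Ψ Y) (Ψ X), ip_comm Y X] at a1
    linarith
  have hr' : ∀ v, ∃ w, Ψ (op v) = op w := by
    intro v
    by_cases hv : v = 0
    · refine ⟨0, ?_⟩
      have : op (0 : Fin n → ℂ) = 0 := by
        have := op_smul 0 (0 : Fin n → ℂ)
        simpa using this
      rw [hv, this, map_zero]
    · obtain ⟨c, x, hx, _, rfl⟩ := normalize hv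
      obtain ⟨b, _, hb⟩ := hr x hx
      exact ⟨(c : ℂ) • b, by rw [op_smul, op_smul, map_smul, hb]⟩
  have hF0 : Fr (fun i : Fin n => (Pi.single i 1 : Fin n → ℂ)) := by
    intro i j
    simp [dotProduct, Pi.single_apply, eq_comm]
  choose w hw hw2 using fun i => hr _ (hF0.unit i)
  have hF := frame_map h1 hF0 hw hw2
  obtain ⟨y, hy⟩ := hr' 1
  let θ : Fin n → ℂ := fun i => star (w i) ⬝ᵥ y
  have hθ : ∀ i, Complex.normSq (θ i) = 1 := by
    intro i
    rw [← ip_op_op, ← hw2, ← hy, hiso, ip_comm, op_single_apply, op_apply]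
    simp
  have hθ' : ∀ i, star (θ i) * θ i = 1 := by
    intro i
    rw [Complex.star_def, ← Complex.normSq_eq_conj_mul_self, hθ]; simp
  let w' : Fin n → Fin n → ℂ := fun i => θ i • w i
  have hopw : ∀ i, op (w' i) = op (w i) := by
    intro i
    rw [op_smul, hθ, one_smul]
  have hF' : Fr w' := by
    intro i j
    simp only [w', star_smul, smul_dotProduct, dotProduct_smul, hF i j]
    split_ifs with h
    · subst h; simpa [mul_comm] using hθ' i
    · simp
  have hy' : ∀ i, star (w' i) ⬝ᵥ y = 1 := by
    intro i
    simp only [w', star_smul, smul_dotProduct]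
    exact hθ' i
  set V : Matrix (Fin n) (Fin n) ℂ := (Matrix.of w')ᵀ with hVdef
  have hV := hF'.unitary
  have hV1 : Vᴴ * V = 1 := by
    have := mem_unitaryGroup_iff'.1 hV
    rwa [star_eq_conjTranspose] at this
  have hV2 : V * Vᴴ = 1 := by
    have := mem_unitaryGroup_iff.1 hV
    rwa [star_eq_conjTranspose] at this
  have hVv : ∀ x i, (Vᴴ *ᵥ x) i = star (w' i) ⬝ᵥ x := by
    intro x i; rfl
  have hback : ∀ X, (Ψ X : Matrix (Fin n) (Fin n) ℂ) = V * (((cj Vᴴ).comp Ψ) X : Matrix (Fin n) (Fin n) ℂ) * Vᴴ := by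
    intro X
    rw [LinearMap.comp_apply, cj_coe, conjTranspose_conjTranspose]
    have : V * (Vᴴ * (Ψ X : Matrix (Fin n) (Fin n) ℂ) * V) * Vᴴ =
      (V * Vᴴ) * (Ψ X : Matrix (Fin n) (Fin n) ℂ) * (V * Vᴴ) := by simp only [mul_assoc]
    rw [this, hV2, one_mul, mul_one]
  have key := wigner_normalized (Ψ := (cj Vᴴ).comp Ψ)
    (by
      intro X Y
      rw [LinearMap.comp_apply, LinearMap.comp_apply, cj_ip, hiso]
      rw [conjTranspose_conjTranspose, hV2])
    (by
      intro v
      obtain ⟨b, hb⟩ := hr' v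
      exact ⟨Vᴴ *ᵥ b, by rw [LinearMap.comp_apply, hb, cj_op]⟩)
    (by
      intro i
      rw [LinearMap.comp_apply, hw2, ← hopw, cj_op]
      congr 1
      ext j
      rw [hVv, hF', Pi.single_apply])
    (by
      rw [LinearMap.comp_apply, hy, cj_op]
      congr 1
      ext j
      rw [hVv, hy']; rfl)
  refine ⟨V, hV, ?_⟩
  rcases key with h | h
  · left; intro X; rw [hback, h]
  · right; intro X; rw [hback, h]

lemma op_of_rank_one {P : BH n} (hP : P ∈ projSet n 1) : ∃ a, star a ⬝ᵥ a = 1 ∧ P = op a := by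
  rw [mem_projSet] at hP
  obtain ⟨hP, htr⟩ := hP
  obtain ⟨u, c, hu, rfl⟩ := spectral P
  have hc : ∀ i, c i = 0 ∨ c i = 1 := by
    intro i
    have h2 : ∀ r, ((∑ i, c i • op (u i) : BH n) : Matrix (Fin n) (Fin n) ℂ) *ᵥ u r = (c r : ℂ) • u r := by
      intro r
      simp only [AddSubgroup.val_finsetSum, selfAdjoint.val_smul, sum_mulVec, op_coe]
      rw [Finset.sum_eq_single r]
      · rw [smul_mulVec, vecMulVec_mulVec, hu.unit]
        ext s; simp
      · intro b _ hb
        rw [smul_mulVec, vecMulVec_mulVec, hu, if_neg hb]; simp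
      · simp
    have h3 := h2 i
    rw [← hP, ← mulVec_mulVec, h2, mulVec_smul, h2, smul_smul] at h3
    have h4 := congrArg (fun x => star (u i) ⬝ᵥ x) h3
    simp only [dotProduct_smul, hu.unit, smul_eq_mul, mul_one] at h4
    have h5 : c i * c i = c i := by exact_mod_cast h4
    by_cases h0 : c i = 0
    · exact Or.inl h0
    · exact Or.inr (mul_left_cancel₀ h0 (by rw [h5, mul_one]))
  have hs : ∑ i, c i = 1 := by
    rw [map_sum] at htr
    simpa [ip_one_op, hu.unit] using htr
  obtain ⟨i, hi⟩ : ∃ i, c i = 1 := by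
    by_contra! h
    have : ∀ i, c i = 0 := fun i => (hc i).resolve_right (h i)
    simp [this] at hs
  have hz : ∀ j, j ≠ i → c j = 0 := by
    intro j hj
    rw [← Finset.add_sum_erase _ _ (Finset.mem_univ i), hi] at hs
    have : ∑ l ∈ Finset.univ.erase i, c l = 0 := by linarith
    rw [Finset.sum_eq_zero_iff_of_nonneg (fun l _ => by rcases hc l with h | h <;> rw [h]; norm_num)] at this
    exact this j (by simp [hj])
  refine ⟨u i, hu.unit i, ?_⟩
  rw [Finset.sum_eq_single i (fun j _ hj => by rw [hz j hj, zero_smul]) (by simp), hi, one_smul]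

lemma op_mem_one (hn : 1 ≤ n) {a : Fin n → ℂ} (ha : star a ⬝ᵥ a = 1) : op a ∈ projSet n 1 := by
  obtain ⟨u, hu, rfl⟩ := exists_frame_one (⟨0, by omega⟩ : Fin n) ha
  simpa using sum_mem hu {⟨0, by omega⟩} (by simp)

lemma case_one (hn : 2 ≤ n) {Φ : BH n →ₗ[ℝ] BH n} (hΦ : (⇑Φ) '' projSet n 1 = projSet n 1) :
    WignerForm n Φ := by
  have hr : ∀ a, star a ⬝ᵥ a = 1 → ∃ b, star b ⬝ᵥ b = 1 ∧ Φ (op a) = op b := fun a ha =>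
    op_of_rank_one (hΦ ▸ Set.mem_image_of_mem _ (op_mem_one (by omega) ha))
  have hsur : ∀ b, star b ⬝ᵥ b = 1 → ∃ a, star a ⬝ᵥ a = 1 ∧ Φ (op a) = op b := by
    intro b hb
    have := op_mem_one (by omega) hb
    rw [← hΦ] at this
    obtain ⟨P, hP, h⟩ := this
    obtain ⟨a, ha, rfl⟩ := op_of_rank_one hP
    exact ⟨a, ha, h⟩
  let i0 : Fin n := ⟨0, by omega⟩
  have hge : ∀ a, star a ⬝ᵥ a = 1 → 1 ≤ ip (Φ 1) (op a) := by
    intro a ha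
    obtain ⟨s, hs, h⟩ := hsur a ha
    obtain ⟨u, hu, hu0⟩ := exists_frame_one i0 hs
    rw [← hu.sum, map_sum, map_sum, LinearMap.sum_apply, ← Finset.add_sum_erase _ _ (Finset.mem_univ i0),
      hu0, h, ip_op_op, ha, Complex.normSq_one]
    have : 0 ≤ ∑ i ∈ Finset.univ.erase i0, ip (Φ (op (u i))) (op a) := by
      apply Finset.sum_nonneg
      intro i _
      obtain ⟨b, _, hb⟩ := hr _ (hu.unit i)
      rw [hb, ip_op_op]
      exact Complex.normSq_nonneg _
    linarith
  have htr : ip 1 (Φ 1) = n := by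
    have hF0 : Fr (fun i : Fin n => (Pi.single i 1 : Fin n → ℂ)) := by
      intro i j
      simp [dotProduct, Pi.single_apply, eq_comm]
    rw [← hF0.sum, map_sum Φ, hF0.sum, map_sum]
    have : ∀ i : Fin n, ip 1 (Φ (op (Pi.single i 1))) = 1 := by
      intro i
      obtain ⟨b, hb, h⟩ := hr _ (hF0.unit i)
      rw [h, ip_one_op, hb]; simp
    simp [this]
  apply wigner _ hr
  rw [← sub_eq_zero]
  apply eq_zero_of_op
  intro a ha
  rw [map_sub, LinearMap.sub_apply, ip_one_op, ha, Complex.one_re, sub_eq_zero]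
  apply le_antisymm _ (hge a ha)
  by_contra! hlt
  obtain ⟨u, hu, hu0⟩ := exists_frame_one i0 ha
  have : ∑ i : Fin n, (1 : ℝ) < ∑ i, ip (Φ 1) (op (u i)) :=
    Finset.sum_lt_sum (fun i _ => hge _ (hu.unit i)) ⟨i0, Finset.mem_univ _, by rw [hu0]; exact hlt⟩
  rw [← map_sum, hu.sum, ip_comm, htr] at this
  simp at this

lemma wigner_adj {Φ Ψ : BH n →ₗ[ℝ] BH n} (hadj : ∀ X Y, ip (Ψ X) Y = ip X (Φ Y))
    (h : WignerForm n Ψ) : WignerForm n Φ := by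
  obtain ⟨U, hU, h | h⟩ := h
  · refine ⟨Uᴴ, ?_, Or.inl ?_⟩
    · exact Unitary.star_mem hU
    intro Y
    rw [← cj_coe]
    congr 1
    rw [← sub_eq_zero]
    apply eq_zero_of_op
    intro v _
    rw [ip_comm, map_sub, ← hadj, sub_eq_zero, ip_def, ip_def, cj_coe, h, conjTranspose_conjTranspose,
      mul_assoc, mul_assoc, trace_mul_comm]
    simp only [mul_assoc]
  · have hUT : Uᵀ ∈ unitaryGroup (Fin n) ℂ := by
      rw [mem_unitaryGroup_iff]
      have := mem_unitaryGroup_iff'.1 hU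
      have h2 := congrArg transpose this
      rw [transpose_mul, transpose_one] at h2
      exact h2
    refine ⟨Uᵀ, hUT, Or.inr ?_⟩
    intro Y
    have hYT : (Y : Matrix (Fin n) (Fin n) ℂ)ᵀ ∈ selfAdjoint (Matrix (Fin n) (Fin n) ℂ) := by
      have hY : (Y : Matrix (Fin n) (Fin n) ℂ)ᴴ = Y := Y.2
      rw [selfAdjoint.mem_iff, star_eq_conjTranspose]
      exact congrArg transpose hY
    change _ = ((cj Uᵀ ⟨_, hYT⟩ : BH n) : Matrix (Fin n) (Fin n) ℂ)
    congr 1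
    rw [← sub_eq_zero]
    apply eq_zero_of_op
    intro v _
    rw [ip_comm, map_sub, ← hadj, sub_eq_zero, ip_def, ip_def, cj_coe, h]
    rw [← trace_transpose ((op v : Matrix (Fin n) (Fin n) ℂ) * _)]
    simp only [transpose_mul, transpose_transpose]
    have hc : Uᵀᴴᵀ = Uᴴ := rfl
    rw [hc, trace_mul_comm _ ((op v : Matrix (Fin n) (Fin n) ℂ)ᵀ), mul_assoc, mul_assoc, trace_mul_comm]
    simp only [mul_assoc]

lemma small {k : ℕ} (hn : 2 ≤ n) (hk : 1 ≤ k) (h : k = 1 ∨ 2 * k < n) {Φ : BH n →ₗ[ℝ] BH n}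
    (hΦ : (⇑Φ) '' projSet n k = projSet n k) : WignerForm n Φ := by
  by_cases h1 : k = 1
  · subst h1; exact case_one hn hΦ
  · have h2 := h.resolve_left h1
    obtain ⟨Ψ, hadj⟩ := exists_adj Φ
    obtain ⟨a1, a2⟩ := rank_one_map hk (by omega) h2 hΦ hadj
    exact wigner_adj hadj (wigner a1 a2)

/-- complementation -/
def cp (k : ℕ) : BH n →ₗ[ℝ] BH n where
  toFun X := ((k : ℝ)⁻¹ * ip 1 X) • (1 : BH n) - X
  map_add' X Y := by simp only [map_add, mul_add, add_smul]; abel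
  map_smul' c X := by
    simp only [map_smul, smul_eq_mul, RingHom.id_apply, smul_sub, smul_smul]
    congr 2; ring

lemma cp_apply (k : ℕ) (X : BH n) : cp k X = ((k : ℝ)⁻¹ * ip 1 X) • (1 : BH n) - X := rfl

lemma cp_proj {k : ℕ} (hk : 1 ≤ k) {P : BH n} (hP : P ∈ projSet n k) : cp k P = 1 - P := by
  have : (k : ℝ) ≠ 0 := by positivity
  rw [cp_apply, (mem_projSet.1 hP).2, inv_mul_cancel₀ this, one_smul]

lemma ip_cp {k : ℕ} (X : BH n) : ip 1 (cp k X) = ((k : ℝ)⁻¹ * n - 1) * ip 1 X := by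
  rw [cp_apply, map_sub, map_smul, ip_one_one, smul_eq_mul]; ring

lemma cp_cp {k : ℕ} (hk : 1 ≤ k) (hkn : k < n) (X : BH n) : cp (n - k) (cp k X) = X := by
  have h1 : (k : ℝ) ≠ 0 := by positivity
  have h2 : ((n : ℝ) - k) ≠ 0 := by
    have : (k : ℝ) < n := by exact_mod_cast hkn
    linarith
  rw [cp_apply, ip_cp, cp_apply, sub_sub_eq_add_sub, sub_eq_iff_eq_add, add_comm, Nat.cast_sub hkn.le]
  congr 2
  field_simp

lemma big {k : ℕ} (hk : 1 ≤ k) (hkn : k < n) (h : n < 2 * k) {Φ : BH n →ₗ[ℝ] BH n}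
    (hΦ : (⇑Φ) '' projSet n k = projSet n k) : WignerForm n Φ := by
  have hnk : n - (n - k) = k := by omega
  have hmap : ∀ P ∈ projSet n k, Φ P ∈ projSet n k := fun P hP => hΦ ▸ Set.mem_image_of_mem _ hP
  have hback : ∀ P ∈ projSet n (n - k), 1 - P ∈ projSet n k := fun P hP => by
    have := compl_mem hP (by omega)
    rwa [hnk] at this
  have hw := small (k := n - k) (Φ := (cp k).comp (Φ.comp (cp (n - k)))) (by omega) (by omega)
    (Or.inr (by omega)) (by
      ext Q
      constructor
      · rintro ⟨P, hP, rfl⟩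
        simp only [LinearMap.comp_apply]
        rw [cp_proj (by omega) hP, cp_proj hk (hmap _ (hback P hP))]
        exact compl_mem (hmap _ (hback P hP)) hkn.le
      · intro hQ
        have h1 := hback Q hQ
        rw [← hΦ] at h1
        obtain ⟨R, hR, hRQ⟩ := h1
        refine ⟨1 - R, compl_mem hR hkn.le, ?_⟩
        simp only [LinearMap.comp_apply]
        rw [cp_proj (by omega) (compl_mem hR hkn.le), sub_sub_cancel, cp_proj hk (hmap R hR), hRQ,
          sub_sub_cancel])
  set Θ := (cp k).comp (Φ.comp (cp (n - k))) with hΘ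
  have hΦΘ : ∀ X, Φ X = cp (n - k) (Θ (cp k X)) := by
    intro X
    simp only [hΘ, LinearMap.comp_apply]
    rw [cp_cp hk hkn, cp_cp hk hkn]
  obtain ⟨U, hU, hc⟩ := hw
  have hU1 : U * Uᴴ = 1 := by
    have := mem_unitaryGroup_iff.1 hU
    rwa [star_eq_conjTranspose] at this
  have hU2 : Uᴴ * U = 1 := by
    have := mem_unitaryGroup_iff'.1 hU
    rwa [star_eq_conjTranspose] at this
  refine ⟨U, hU, ?_⟩
  rcases hc with hc | hc
  · left
    have e1 : Θ 1 = 1 := Subtype.ext (by rw [hc]; simpa using hU1)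
    have e2 : ∀ X, ip 1 (Θ X) = ip 1 X := fun X => by
      rw [ip_one, ip_one, hc, mul_assoc, trace_mul_comm, mul_assoc, hU2, mul_one]
    intro X
    have : Φ X = Θ X := by
      rw [hΦΘ, cp_apply (n - k), e2]
      have h3 := congrArg Θ (cp_cp hk hkn X)
      rw [cp_apply (n - k) (cp k X), map_sub, map_smul, e1] at h3
      exact h3
    rw [this, hc]
  · right
    have e1 : Θ 1 = 1 := Subtype.ext (by rw [hc]; simpa using hU1)
    have e2 : ∀ X, ip 1 (Θ X) = ip 1 X := fun X => by
      rw [ip_one, ip_one, hc, mul_assoc, trace_mul_comm, mul_assoc, hU2, mul_one, trace_transpose]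
    intro X
    have : Φ X = Θ X := by
      rw [hΦΘ, cp_apply (n - k), e2]
      have h3 := congrArg Θ (cp_cp hk hkn X)
      rw [cp_apply (n - k) (cp k X), map_sub, map_smul, e1] at h3
      exact h3
    rw [this, hc]

end WF

theorem stmt_3 (n k : ℕ) (hn : n.Prime) (hk1 : 1 ≤ k) (hkn : k ≤ n - 1)
    (Φ : BH n →ₗ[ℝ] BH n)
    (hΦ : (⇑Φ) '' projSet n k = projSet n k) :
    WignerForm n Φ := by
  have h2 := hn.two_le
  rcases lt_trichotomy (2 * k) n with h | h | h
  · exact WF.small h2 hk1 (Or.inr h) hΦ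
  · refine WF.small h2 hk1 (Or.inl ?_) hΦ
    have : 2 = n := ((Nat.prime_dvd_prime_iff_eq Nat.prime_two hn).1 ⟨k, h.symm⟩)
    omega
  · exact WF.big hk1 (by omega) h hΦ
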